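/- Let H₁, H₂, H₃ be complex Hilbert spaces and let T from H₁ to H₂ and S from H₂ to H₃ be closed densely defined linear operators with ran T ⊆ ker S. Suppose the quotient vector space ker S / ran T is finite-dimensional (equivalently, there is a finite-dimensional subspace W ⊆ ker S with ker S = ran T + W). Then ran T is closed in H₂, its adjoint T* has closed range in H₁, there is an orthogonal decomposition H₂ = ran T ⊕ cl(ran S*) ⊕ (ker S ∩ ker T*), and the composition of the inclusion ker S ∩ ker T* ↪ ker S with the quotient map ker S → ker S / ran T is a linear isomorphism. -/

import Mathlib

open scoped InnerProductSpace

noncomputable section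

variable {H₁ H₂ H₃ : Type*}
  [NormedAddCommGroup H₁] [InnerProductSpace ℂ H₁] [CompleteSpace H₁]
  [NormedAddCommGroup H₂] [InnerProductSpace ℂ H₂] [CompleteSpace H₂]
  [NormedAddCommGroup H₃] [InnerProductSpace ℂ H₃] [CompleteSpace H₃]

/-- The range of a partially defined linear operator, as a submodule of the codomain. -/
def LinearPMap.ran {E F : Type*} [NormedAddCommGroup E] [InnerProductSpace ℂ E]
    [NormedAddCommGroup F] [InnerProductSpace ℂ F] (T : E →ₗ.[ℂ] F) : Submodule ℂ F :=
  LinearMap.range T.toFun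

/-- The kernel of a partially defined linear operator, as a submodule of the domain space. -/
def LinearPMap.ker' {E F : Type*} [NormedAddCommGroup E] [InnerProductSpace ℂ E]
    [NormedAddCommGroup F] [InnerProductSpace ℂ F] (T : E →ₗ.[ℂ] F) : Submodule ℂ E :=
  (LinearMap.ker T.toFun).map T.domain.subtype

namespace LinearPMap

variable {E F : Type*} [NormedAddCommGroup E] [InnerProductSpace ℂ E]
  [NormedAddCommGroup F] [InnerProductSpace ℂ F]

theorem mem_ran_iff {T : E →ₗ.[ℂ] F} {y : F} : y ∈ T.ran ↔ ∃ x : T.domain, T x = y :=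
  Iff.rfl

theorem mem_ker'_iff {T : E →ₗ.[ℂ] F} {x : E} : x ∈ T.ker' ↔ (x, (0 : F)) ∈ T.graph := by
  simp only [ker', Submodule.mem_map, LinearMap.mem_ker, mem_graph_iff, toFun_eq_coe,
    Submodule.subtype_apply]
  exact exists_congr fun _ => and_comm

theorem isClosed_ker' {T : E →ₗ.[ℂ] F} (hT : T.IsClosed) : _root_.IsClosed (T.ker' : Set E) := by
  have h : (T.ker' : Set E) = (fun x => (x, (0 : F))) ⁻¹' (T.graph : Set (E × F)) :=
    Set.ext fun _ => mem_ker'_iff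
  rw [h]
  exact _root_.IsClosed.preimage (by fun_prop) hT

theorem completeSpace_graph [CompleteSpace E] [CompleteSpace F] {T : E →ₗ.[ℂ] F}
    (hT : T.IsClosed) : CompleteSpace T.graph :=
  have h : _root_.IsClosed (T.graph : Set (E × F)) := hT
  h.completeSpace_coe

/-- If the range of a closed operator has a finite-dimensional complement in a closed subspace,
then the range is closed. -/
theorem isClosed_ran_of_sup_finiteDimensional [CompleteSpace E] [CompleteSpace F]
    {T : E →ₗ.[ℂ] F} (hT : T.IsClosed) (W : Submodule ℂ F) [FiniteDimensional ℂ W]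
    (hW : _root_.IsClosed ((T.ran ⊔ W : Submodule ℂ F) : Set F)) : _root_.IsClosed (T.ran : Set F) := by
  obtain ⟨V, hdisj, hsup⟩ :=
    IsModularLattice.exists_disjoint_and_sup_eq (inf_le_right : T.ran ⊓ W ≤ W)
  have hVW : V ≤ W := hsup ▸ le_sup_right
  have : FiniteDimensional ℂ V := Submodule.finiteDimensional_of_le hVW
  have hTV : T.ran ⊔ V = T.ran ⊔ W := by
    rw [← hsup, ← sup_assoc, sup_eq_left.2 (inf_le_left : T.ran ⊓ W ≤ T.ran)]
  have hdisjTV : Disjoint T.ran V := by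
    rw [disjoint_iff, ← inf_eq_right.2 hVW, ← inf_assoc]
    exact hdisj.eq_bot
  set K := T.ran ⊔ W
  have : CompleteSpace K := hW.completeSpace_coe
  have : CompleteSpace T.graph := completeSpace_graph hT
  have hgraph (g : T.graph) : (g : E × F).2 ∈ T.ran := by
    obtain ⟨y, -, hy⟩ := (mem_graph_iff T).1 g.2
    exact ⟨y, hy⟩
  let f : T.graph × V →L[ℂ] F :=
    ((ContinuousLinearMap.snd ℂ E F).comp T.graph.subtypeL).coprod V.subtypeL
  have hf (p : T.graph × V) : f p = (p.1 : E × F).2 + p.2 := rfl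
  have hfK (p : T.graph × V) : f p ∈ K :=
    hTV ▸ Submodule.add_mem_sup (hgraph p.1) p.2.2
  have hsurj : Function.Surjective (f.codRestrict K hfK) := by
    rintro ⟨k, hk⟩
    obtain ⟨_, ⟨x, rfl⟩, v, hv, rfl⟩ := Submodule.mem_sup.1 (hTV ▸ hk)
    exact ⟨(⟨(x, T x), T.mem_graph x⟩, ⟨v, hv⟩), rfl⟩
  have hpre : f.codRestrict K hfK ⁻¹' (Subtype.val ⁻¹' (T.ran : Set F)) = Prod.snd ⁻¹' {0} := by
    ext p
    simp only [Set.mem_preimage, ContinuousLinearMap.coe_codRestrict_apply, SetLike.mem_coe,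
      Set.mem_singleton_iff, hf, Submodule.add_mem_iff_right _ (hgraph p.1)]
    refine ⟨fun h => ?_, fun h => by simp [h]⟩
    exact Subtype.ext (Submodule.disjoint_def.1 hdisjTV _ h p.2.2)
  have hclosed : _root_.IsClosed (Subtype.val ⁻¹' (T.ran : Set F) : Set K) := by
    rw [← ((f.codRestrict K hfK).isQuotientMap hsurj).isClosed_preimage, hpre]
    exact isClosed_singleton.preimage continuous_snd
  have himage : Subtype.val '' (Subtype.val ⁻¹' (T.ran : Set F) : Set K) = T.ran :=
    Set.image_preimage_eq_of_subset fun y hy => ⟨⟨y, (le_sup_left : T.ran ≤ K) hy⟩, rfl⟩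
  rw [← himage]
  exact hW.isClosedEmbedding_subtypeVal.isClosedMap _ hclosed

section Adjoint

variable [CompleteSpace E] {T : E →ₗ.[ℂ] F}

theorem mem_graph_adjoint_iff (hT : Dense (T.domain : Set E)) {y : F} {w : E} :
    (y, w) ∈ T.adjoint.graph ↔ ∀ x : T.domain, ⟪w, (x : E)⟫_ℂ = ⟪y, T x⟫_ℂ := by
  rw [mem_graph_iff]
  constructor
  · rintro ⟨⟨_, hz⟩, rfl, rfl⟩ x
    exact adjoint_isFormalAdjoint hT ⟨_, hz⟩ x
  · intro h
    exact ⟨⟨y, mem_adjoint_domain_of_exists y ⟨w, h⟩⟩, rfl, adjoint_apply_eq hT _ h⟩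

theorem mem_adjoint_ran_iff (hT : Dense (T.domain : Set E)) {w : E} :
    w ∈ T.adjoint.ran ↔ ∃ y : F, ∀ x : T.domain, ⟪w, (x : E)⟫_ℂ = ⟪y, T x⟫_ℂ := by
  simp_rw [← mem_graph_adjoint_iff hT, mem_ran_iff, mem_graph_iff]
  constructor
  · rintro ⟨y, hy⟩
    exact ⟨y, y, rfl, hy⟩
  · rintro ⟨_, y, -, hy⟩
    exact ⟨y, hy⟩

theorem adjoint_ker' (hT : Dense (T.domain : Set E)) : T.adjoint.ker' = T.ranᗮ := by
  ext y
  rw [mem_ker'_iff, mem_graph_adjoint_iff hT, Submodule.mem_orthogonal']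
  simp only [inner_zero_left, mem_ran_iff, forall_exists_index, forall_apply_eq_imp_iff]
  exact forall_congr' fun _ => eq_comm

theorem ker'_le_orthogonal_adjoint_ran (hT : Dense (T.domain : Set E)) :
    T.ker' ≤ T.adjoint.ranᗮ := by
  intro x hx w hw
  obtain ⟨y, hy⟩ := (mem_adjoint_ran_iff hT).1 hw
  obtain ⟨z, rfl, hz⟩ := (mem_graph_iff T).1 (mem_ker'_iff.1 hx)
  rw [hy z, hz, inner_zero_right]

theorem orthogonal_adjoint_ran [CompleteSpace F] (hT : Dense (T.domain : Set E))
    (hT_closed : T.IsClosed) : T.adjoint.ranᗮ = T.ker' := by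
  refine le_antisymm (fun x hx => ?_) (ker'_le_orthogonal_adjoint_ran hT)
  let G : Submodule ℂ (WithLp 2 (E × F)) :=
    T.graph.comap (WithLp.linearEquiv 2 ℂ (E × F)).toLinearMap
  have hG : _root_.IsClosed (G : Set (WithLp 2 (E × F))) :=
    _root_.IsClosed.preimage (WithLp.prod_continuous_ofLp 2 E F) hT_closed
  have hGG : Gᗮᗮ = G := by
    rw [Submodule.orthogonal_orthogonal_eq_closure, hG.submodule_topologicalClosure_eq]
  have hxG : WithLp.toLp 2 (x, (0 : F)) ∈ Gᗮᗮ := by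
    intro p hp
    have hran : p.fst ∈ T.adjoint.ran := by
      refine (mem_adjoint_ran_iff hT).2 ⟨-p.snd, fun z => ?_⟩
      have hz := (Submodule.mem_orthogonal' G p).1 hp (WithLp.toLp 2 ((z : E), T z))
        (T.mem_graph z)
      simp only [WithLp.prod_inner_apply] at hz
      rw [inner_neg_left]
      exact eq_neg_of_add_eq_zero_left hz
    simpa [WithLp.prod_inner_apply] using hx _ hran
  rw [hGG] at hxG
  exact mem_ker'_iff.2 hxG

/-- The range of the adjoint of a closed densely defined operator with closed range is the
orthogonal complement of the kernel. -/
theorem adjoint_ran_eq_orthogonal_ker' [CompleteSpace F] (hT : Dense (T.domain : Set E))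
    (hT_closed : T.IsClosed) (hran : _root_.IsClosed (T.ran : Set F)) :
    T.adjoint.ran = T.ker'ᗮ := by
  refine le_antisymm ((Submodule.le_orthogonal_orthogonal _).trans
    (Submodule.orthogonal_le (ker'_le_orthogonal_adjoint_ran hT))) fun v hv => ?_
  have : CompleteSpace T.ran := hran.completeSpace_coe
  have : CompleteSpace T.graph := completeSpace_graph hT_closed
  let π : T.graph →L[ℂ] T.ran :=
    ((ContinuousLinearMap.snd ℂ E F).comp T.graph.subtypeL).codRestrict T.ran fun g => by
      obtain ⟨y, -, hy⟩ := (mem_graph_iff T).1 g.2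
      exact ⟨y, hy⟩
  have hπ : Function.Surjective π := by
    rintro ⟨_, x, rfl⟩
    exact ⟨⟨(x, T x), T.mem_graph x⟩, rfl⟩
  let ψ : T.graph →L[ℂ] ℂ :=
    (innerSL ℂ v).comp ((ContinuousLinearMap.fst ℂ E F).comp T.graph.subtypeL)
  have hker : π.toLinearMap.ker ≤ ψ.toLinearMap.ker := by
    rintro ⟨⟨a, b⟩, hg⟩ h
    obtain rfl : b = 0 := congrArg Subtype.val (LinearMap.mem_ker.1 h)
    exact (Submodule.mem_orthogonal' _ _).1 hv a (mem_ker'_iff.2 hg)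
  let l : T.ran →ₗ[ℂ] ℂ := (π.toLinearMap.ker.liftQ ψ.toLinearMap hker).comp
    (π.toLinearMap.quotKerEquivOfSurjective hπ).symm.toLinearMap
  have hl (g : T.graph) : l (π g) = ψ g := by
    have h : (π.toLinearMap.quotKerEquivOfSurjective hπ).symm (π g) =
        π.toLinearMap.ker.mkQ g := by
      rw [LinearEquiv.symm_apply_eq]
      rfl
    simp only [l, LinearMap.comp_apply, LinearEquiv.coe_coe, h]
    rfl
  have hlcont : Continuous l := by
    rw [(π.isQuotientMap hπ).continuous_iff]
    exact ψ.continuous.congr fun g => (hl g).symm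
  let u : T.ran := (InnerProductSpace.toDual ℂ T.ran).symm ⟨l, hlcont⟩
  refine (mem_adjoint_ran_iff hT).2 ⟨u, fun x => ?_⟩
  have hu : ⟪u, (⟨T x, x, rfl⟩ : T.ran)⟫_ℂ = l ⟨T x, x, rfl⟩ :=
    InnerProductSpace.toDual_symm_apply
  exact (hl ⟨(x, T x), T.mem_graph x⟩).symm.trans hu.symm

end Adjoint

end LinearPMap

namespace Submodule

variable {E : Type*} [NormedAddCommGroup E] [InnerProductSpace ℂ E]

/-- For `R ≤ K`, the orthogonal complement of `R` in `K` is isomorphic to `K / R`. -/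
theorem bijective_mkQ_comp_inclusion_inf_orthogonal {R K : Submodule ℂ E} (hRK : R ≤ K)
    [R.HasOrthogonalProjection] :
    Function.Bijective ((R.comap K.subtype).mkQ.comp
      (Submodule.inclusion (inf_le_left : K ⊓ Rᗮ ≤ K))) := by
  constructor
  · rw [← LinearMap.ker_eq_bot, LinearMap.ker_eq_bot']
    rintro ⟨x, hxK, hxR⟩ h
    have hx : x ∈ R := by
      simpa using h
    exact Subtype.ext (Submodule.disjoint_def.1 R.orthogonal_disjoint x hx hxR)
  · intro q
    obtain ⟨⟨k, hk⟩, rfl⟩ := Submodule.mkQ_surjective _ q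
    obtain ⟨r, hr, z, hz, rfl⟩ := Submodule.mem_sup.1
      ((sup_orthogonal_inf_of_hasOrthogonalProjection hRK).symm ▸ hk)
    refine ⟨⟨z, hz.2, hz.1⟩, ?_⟩
    refine (Submodule.Quotient.eq _).2 ?_
    simpa using hr

end Submodule

/-- **Harmonic representation with finite-dimensional cohomology.**
If `T : H₁ → H₂` and `S : H₂ → H₃` are closed densely defined operators with
`ran T ⊆ ker S` and the cohomology `ker S / ran T` is finite-dimensional
(i.e. `ker S = ran T + W` for some finite-dimensional `W ⊆ ker S`), then `ran T` is
closed, `ran T*` is closed, `H₂ = ran T ⊕ cl(ran S*) ⊕ (ker S ∩ ker T*)` orthogonally,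
and the harmonic space `ker S ∩ ker T*` maps isomorphically onto `ker S / ran T`. -/
theorem harmonic_representation_finite_dim
    (T : H₁ →ₗ.[ℂ] H₂) (S : H₂ →ₗ.[ℂ] H₃)
    (hT_dense : Dense (T.domain : Set H₁)) (hS_dense : Dense (S.domain : Set H₂))
    (hT_closed : T.IsClosed) (hS_closed : S.IsClosed)
    (hTS : T.ran ≤ S.ker')
    (hfin : ∃ W : Submodule ℂ H₂, W ≤ S.ker' ∧ FiniteDimensional ℂ W ∧
      S.ker' = T.ran ⊔ W) :
    IsClosed (T.ran : Set H₂) ∧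
    IsClosed (T.adjoint.ran : Set H₁) ∧
    (∀ x ∈ T.ran, ∀ y ∈ (S.adjoint.ran).topologicalClosure, ⟪x, y⟫_ℂ = 0) ∧
    (∀ x ∈ T.ran, ∀ z ∈ S.ker' ⊓ T.adjoint.ker', ⟪x, z⟫_ℂ = 0) ∧
    (∀ y ∈ (S.adjoint.ran).topologicalClosure, ∀ z ∈ S.ker' ⊓ T.adjoint.ker',
      ⟪y, z⟫_ℂ = 0) ∧
    T.ran ⊔ (S.adjoint.ran).topologicalClosure ⊔ (S.ker' ⊓ T.adjoint.ker') = ⊤ ∧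
    Function.Bijective
      ((T.ran.comap S.ker'.subtype).mkQ.comp
        (Submodule.inclusion (inf_le_left : S.ker' ⊓ T.adjoint.ker' ≤ S.ker'))) := by
  obtain ⟨W, -, _, hW⟩ := hfin
  have hker_closed : IsClosed (S.ker' : Set H₂) := LinearPMap.isClosed_ker' hS_closed
  have hran : IsClosed (T.ran : Set H₂) :=
    LinearPMap.isClosed_ran_of_sup_finiteDimensional hT_closed W (hW ▸ hker_closed)
  have : CompleteSpace T.ran := hran.completeSpace_coe
  have : CompleteSpace S.ker' := hker_closed.completeSpace_coe
  have hclosure : S.adjoint.ran.topologicalClosure = S.ker'ᗮ := by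
    rw [← Submodule.orthogonal_orthogonal_eq_closure,
      LinearPMap.orthogonal_adjoint_ran hS_dense hS_closed]
  rw [hclosure, LinearPMap.adjoint_ker' hT_dense,
    LinearPMap.adjoint_ran_eq_orthogonal_ker' hT_dense hT_closed hran]
  refine ⟨hran, Submodule.isClosed_orthogonal _, fun x hx y hy => hy x (hTS hx),
    fun x hx z hz => hz.2 x hx, fun y hy z hz => Submodule.inner_left_of_mem_orthogonal hz.1 hy,
    ?_, Submodule.bijective_mkQ_comp_inclusion_inf_orthogonal hTS⟩
  rw [sup_right_comm, inf_comm, Submodule.sup_orthogonal_inf_of_hasOrthogonalProjection hTS,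
    Submodule.sup_orthogonal_of_hasOrthogonalProjection]
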